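/- For positive integers t, s, h: s_{q^m/q}(tsh, ts) ≤ t · s_{q^m/q}(sh, s), provided ts ≤ min{tsh, m}. -/

import Mathlib

/-- `U` covers with radius `r`: every vector of `F_{q^m}^k` lies in the `F_{q^m}`-span
of an `F_q`-subspace of `U` of `F_q`-dimension at most `r`. -/
def RkCovers (K : Type*) {L : Type*} [Field K] [Field L] [Algebra K L]
    {ι : Type*} (U : Submodule K (ι → L)) (r : ℕ) : Prop :=
  ∀ v : ι → L, ∃ S : Submodule K (ι → L), S ≤ U ∧ Module.finrank K S ≤ r ∧
    v ∈ Submodule.span L (S : Set (ι → L))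

/-- `U` is rank-`ρ`-saturating: it covers with radius `ρ` and `ρ` is minimal. -/
def IsRankSat (K : Type*) {L : Type*} [Field K] [Field L] [Algebra K L]
    {ι : Type*} (U : Submodule K (ι → L)) (ρ : ℕ) : Prop :=
  RkCovers K U ρ ∧ ∀ r < ρ, ¬ RkCovers K U r

/-- `s_{q^m/q}(k, ρ)`: the minimal `F_q`-dimension of a rank-`ρ`-saturating
`[n,k]_{q^m/q}` system in `F_{q^m}^k`. -/
noncomputable def sMin (K L : Type*) [Field K] [Field L] [Algebra K L] (k ρ : ℕ) : ℕ :=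
  sInf {n : ℕ | ∃ U : Submodule K (Fin k → L),
    Module.finrank K U = n ∧ Submodule.span L (U : Set (Fin k → L)) = ⊤ ∧
      IsRankSat K U ρ}

theorem RkCovers.span_eq_top {K L : Type*} [Field K] [Field L] [Algebra K L]
    {ι : Type*} {U : Submodule K (ι → L)} {r : ℕ} (hU : RkCovers K U r) :
    Submodule.span L (U : Set (ι → L)) = ⊤ := by
  rw [eq_top_iff]
  intro v _
  obtain ⟨S, hS, -, hv⟩ := hU v
  exact Submodule.span_mono hS hv

theorem RkCovers.mono {K L : Type*} [Field K] [Field L] [Algebra K L]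
    {ι : Type*} {U : Submodule K (ι → L)} {r r' : ℕ} (hU : RkCovers K U r) (h : r ≤ r') :
    RkCovers K U r' := by
  intro v
  obtain ⟨S, hS, h1, hv⟩ := hU v
  exact ⟨S, hS, h1.trans h, hv⟩

theorem finrank_iSup_le_mul {K V : Type*} [Field K] [AddCommGroup V] [Module K V]
    [FiniteDimensional K V] {α : Type*} (s : Finset α) (W : α → Submodule K V) (d : ℕ)
    (hW : ∀ a, Module.finrank K (W a) ≤ d) :
    Module.finrank K (⨆ a ∈ s, W a : Submodule K V) ≤ s.card * d := by
  classical
  induction s using Finset.induction_on with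
  | empty => simp
  | insert a s ha ih =>
    rw [Finset.iSup_insert, Finset.card_insert_of_notMem ha]
    have := Submodule.finrank_add_le_finrank_add_finrank (W a) (⨆ x ∈ s, W x)
    have h2 := hW a
    rw [add_mul, one_mul]
    omega

/-- A system all of whose coordinates lie in the small field has large radius. -/
theorem not_covers_of_coords {K L : Type*} [Field K] [Field L] [Algebra K L]
    [FiniteDimensional K L] {ι κ : Type*} [Fintype ι] [Fintype κ]
    (b : Module.Basis κ L (ι → L)) (U : Submodule K (ι → L))
    (hU : ∀ u ∈ U, ∀ i, b.repr u i ∈ (algebraMap K L).range) {r ρ : ℕ} (hr : r < ρ)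
    (h1 : ρ ≤ Fintype.card κ) (h2 : ρ ≤ Module.finrank K L) : ¬ RkCovers K U r := by
  intro hc
  obtain ⟨g⟩ : Nonempty (Fin ρ ↪ κ) :=
    Function.Embedding.nonempty_of_card_le (by simpa using h1)
  let c : Fin ρ → L := fun i => Module.finBasis K L (Fin.castLE h2 i)
  have hcl : LinearIndependent K c :=
    (Module.finBasis K L).linearIndependent.comp _ (Fin.castLE_injective h2)
  let f : κ → L := Function.extend g c 0
  obtain ⟨S, hS, hd, hv⟩ := hc (b.equivFun.symm f)
  let sb := Module.finBasis K S
  have hle : Submodule.span L (S : Set (ι → L)) ≤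
      Submodule.span L (Set.range (fun j => (sb j : ι → L))) := by
    rw [Submodule.span_le]
    intro x hx
    have h := sb.sum_repr ⟨x, hx⟩
    have h' := congrArg (Subtype.val) h
    rw [show x = _ from h'.symm]
    simp only [AddSubmonoidClass.coe_finsetSum, Submodule.coe_smul]
    refine Submodule.sum_mem _ fun j _ => ?_
    rw [← algebraMap_smul L]
    exact Submodule.smul_mem _ _ (Submodule.subset_span ⟨j, rfl⟩)
  obtain ⟨l, hl⟩ := (Submodule.mem_span_range_iff_exists_fun L).1 (hle hv)
  have hf : ∀ i, f i ∈ Submodule.span K (Set.range l) := by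
    intro i
    have h : f i = ∑ j, l j * b.repr (sb j : ι → L) i := by
      have := congrArg (fun w => b.equivFun w i) hl
      simp only [LinearEquiv.apply_symm_apply] at this
      rw [← this]
      simp [Module.Basis.equivFun_apply]
    rw [h]
    refine Submodule.sum_mem _ fun j _ => ?_
    obtain ⟨a, ha⟩ := hU _ (hS (sb j).2) i
    rw [← ha, mul_comm, ← Algebra.smul_def]
    exact Submodule.smul_mem _ _ (Submodule.subset_span ⟨j, rfl⟩)
  have hsp : Submodule.span K (Set.range c) ≤ Submodule.span K (Set.range l) := by
    rw [Submodule.span_le]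
    rintro _ ⟨i, rfl⟩
    have := hf (g i)
    rwa [show f (g i) = c i from g.injective.extend_apply _ _ _] at this
  have e1 := Submodule.finrank_mono hsp
  rw [finrank_span_eq_card hcl] at e1
  have e2 := finrank_range_le_card (R := K) l
  simp only [Set.finrank, Fintype.card_fin] at e1 e2
  omega

/-- One step: make the `i`-th coordinate trivial. -/
theorem step_exists {K L : Type*} [Field K] [Field L] [Algebra K L]
    [FiniteDimensional K L] {ι κ : Type*} [Fintype ι] [Fintype κ]
    (b : Module.Basis κ L (ι → L)) (U : Submodule K (ι → L)) (hb : ∀ i, b i ∈ U)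
    (T : Set κ) (hT : ∀ u ∈ U, ∀ i ∈ T, b.repr u i ∈ (algebraMap K L).range)
    (r : ℕ) (hc : RkCovers K U r) (i : κ) :
    ∃ U' : Submodule K (ι → L), (∀ i, b i ∈ U') ∧
      (∀ u ∈ U', ∀ j ∈ insert i T, b.repr u j ∈ (algebraMap K L).range) ∧
      RkCovers K U' (r + 1) ∧ Module.finrank K U' ≤ Module.finrank K U := by
  classical
  let P : (ι → L) →ₗ[L] (ι → L) := LinearMap.id - (b.coord i).smulRight (b i)
  have hP : ∀ v, P v = v - b.repr v i • b i := fun v => by simp [P]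
  have hPi : P (b i) = 0 := by simp [hP]
  let PK : (ι → L) →ₗ[K] (ι → L) := P.restrictScalars K
  have hsm : ∀ W : Submodule K (ι → L),
      Module.finrank K (W.map PK ⊔ Submodule.span K {b i} : Submodule K (ι → L)) ≤
        Module.finrank K (W.map PK) + 1 := by
    intro W
    have h1 := Submodule.finrank_add_le_finrank_add_finrank (W.map PK) (Submodule.span K {b i})
    have h2 : Module.finrank K (Submodule.span K {b i}) = 1 :=
      finrank_span_singleton (b.ne_zero i)
    omega
  refine ⟨U.map PK ⊔ Submodule.span K {b i}, ?_, ?_, ?_, ?_⟩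
  · intro j
    by_cases hj : j = i
    · subst hj
      exact Submodule.mem_sup_right (Submodule.mem_span_singleton_self _)
    · refine Submodule.mem_sup_left ⟨b j, hb j, ?_⟩
      change P (b j) = b j
      simp [hP, hj]
  · intro u hu j hj
    obtain ⟨y, ⟨x, hx, rfl⟩, z, hz, rfl⟩ := Submodule.mem_sup.1 hu
    obtain ⟨a, rfl⟩ := Submodule.mem_span_singleton.1 hz
    rw [map_add, Finsupp.add_apply]
    refine add_mem ?_ ?_
    · change b.repr (P x) j ∈ _
      by_cases hji : j = i
      · subst hji
        simp [hP]
      · have := hT x hx j (hj.resolve_left hji)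
        simpa [hP, Finsupp.single_apply, Ne.symm hji] using this
    · rw [← algebraMap_smul L a (b i), map_smul, b.repr_self, Finsupp.smul_apply,
        Finsupp.single_apply]
      split_ifs
      · exact ⟨a, by simp⟩
      · exact ⟨0, by simp⟩
  · intro v
    obtain ⟨S, hS, hd, hv⟩ := hc v
    refine ⟨S.map PK ⊔ Submodule.span K {b i}, sup_le_sup_right (Submodule.map_mono hS) _,
      ?_, ?_⟩
    · have := hsm S
      have h3 := Submodule.finrank_map_le PK S
      omega
    · have hv' : v = P v + b.repr v i • b i := by rw [hP]; simp
      rw [hv']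
      refine add_mem ?_ (Submodule.smul_mem _ _ (Submodule.subset_span
        (Submodule.mem_sup_right (Submodule.mem_span_singleton_self _))))
      have h4 : P v ∈ (Submodule.span L (S : Set (ι → L))).map P := ⟨v, hv, rfl⟩
      rw [Submodule.map_span] at h4
      refine Submodule.span_mono ?_ h4
      rintro _ ⟨x, hx, rfl⟩
      exact Submodule.mem_sup_left ⟨x, hx, rfl⟩
  · refine (hsm U).trans ?_
    have h5 := LinearMap.finrank_range_add_finrank_ker (PK.domRestrict U)
    have h6 : LinearMap.range (PK.domRestrict U) = U.map PK := LinearMap.range_domRestrict _ _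
    rw [h6] at h5
    have h7 : 0 < Module.finrank K (LinearMap.ker (PK.domRestrict U)) := by
      refine (Module.finrank_pos_iff_exists_ne_zero (R := K)
        (M := LinearMap.ker (PK.domRestrict U))).2 ?_
      refine ⟨⟨⟨b i, hb i⟩, hPi⟩, fun h => b.ne_zero i ?_⟩
      exact congrArg Subtype.val (congrArg Subtype.val h)
    omega

theorem exists_exact {K L : Type*} [Field K] [Field L] [Algebra K L]
    [FiniteDimensional K L] {k ρ : ℕ} (U : Submodule K (Fin k → L)) (hU : RkCovers K U ρ)
    (hρ : 0 < ρ) (h1 : ρ ≤ k) (h2 : ρ ≤ Module.finrank K L) :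
    ∃ U' : Submodule K (Fin k → L), Module.finrank K U' ≤ Module.finrank K U ∧
      Submodule.span L (U' : Set (Fin k → L)) = ⊤ ∧ IsRankSat K U' ρ := by
  classical
  by_contra hcon
  obtain ⟨r, rfl⟩ : ∃ r, ρ = r + 1 := ⟨ρ - 1, by omega⟩
  have key : ∀ W : Submodule K (Fin k → L), Module.finrank K W ≤ Module.finrank K U →
      RkCovers K W (r + 1) → RkCovers K W r := by
    intro W hW hc
    by_contra hn
    exact hcon ⟨W, hW, hc.span_eq_top, hc, fun r' hr' h => hn (h.mono (by omega))⟩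
  obtain ⟨κ, ⟨b, hb⟩⟩ : ∃ κ : Set (Fin k → L), ∃ b : Module.Basis κ L (Fin k → L),
      ∀ i, b i ∈ U :=
    ⟨_, Module.Basis.ofSpan hU.span_eq_top.ge, fun i =>
      Module.Basis.ofSpan_subset hU.span_eq_top.ge ⟨i, rfl⟩⟩
  have : Finite κ := Module.Finite.finite_basis b
  have := Fintype.ofFinite κ
  have hall : ∀ T : Finset κ, ∃ W : Submodule K (Fin k → L), (∀ i, b i ∈ W) ∧
      (∀ u ∈ W, ∀ j ∈ (T : Set κ), b.repr u j ∈ (algebraMap K L).range) ∧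
      RkCovers K W r ∧ Module.finrank K W ≤ Module.finrank K U := by
    intro T
    induction T using Finset.induction_on with
    | empty => exact ⟨U, hb, by simp, key U le_rfl hU, le_rfl⟩
    | insert i T hi ih =>
      obtain ⟨W, w1, w2, w3, w4⟩ := ih
      obtain ⟨W', v1, v2, v3, v4⟩ := step_exists b W w1 _ w2 r w3 i
      refine ⟨W', v1, ?_, key W' (v4.trans w4) v3, v4.trans w4⟩
      rw [Finset.coe_insert]
      exact v2
  obtain ⟨W, w1, w2, w3, w4⟩ := hall Finset.univ
  refine not_covers_of_coords b W (fun u hu i => w2 u hu i (by simp)) (Nat.lt_succ_self r)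
    ?_ h2 w3
  rw [← Module.finrank_eq_card_basis b]
  simpa using h1

theorem covers_top {K L : Type*} [Field K] [Field L] [Algebra K L] {ι : Type*} :
    RkCovers K (⊤ : Submodule K (ι → L)) 1 := by
  intro v
  refine ⟨Submodule.span K {v}, le_top, ?_,
    Submodule.subset_span (Submodule.mem_span_singleton_self v)⟩
  simpa using finrank_span_le_card (R := K) ({v} : Set (ι → L))

/-- Repeated direct sum. -/
theorem covers_repeat {K L : Type*} [Field K] [Field L] [Algebra K L]
    [FiniteDimensional K L] {k k' t r : ℕ} (e : Fin k' ≃ Fin t × Fin k)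
    (U : Submodule K (Fin k → L)) (hU : RkCovers K U r) :
    ∃ W : Submodule K (Fin k' → L), Module.finrank K W ≤ t * Module.finrank K U ∧
      RkCovers K W (t * r) := by
  classical
  let inj : Fin t → (Fin k → L) →ₗ[L] (Fin k' → L) := fun a =>
    { toFun := fun w x => if (e x).1 = a then w (e x).2 else 0
      map_add' := fun x y => by ext z; by_cases h : (e z).1 = a <;> simp [h]
      map_smul' := fun c y => by ext z; by_cases h : (e z).1 = a <;> simp [h] }
  have hinj : ∀ a w x, inj a w x = if (e x).1 = a then w (e x).2 else 0 := fun _ _ _ => rfl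
  refine ⟨⨆ a ∈ Finset.univ, U.map ((inj a).restrictScalars K), ?_, ?_⟩
  · simpa using finrank_iSup_le_mul (Finset.univ : Finset (Fin t))
      (fun a => U.map ((inj a).restrictScalars K)) _ (fun a => Submodule.finrank_map_le _ U)
  · intro v
    choose S hS hd hv using fun a : Fin t => hU (fun j => v (e.symm (a, j)))
    refine ⟨⨆ a ∈ Finset.univ, (S a).map ((inj a).restrictScalars K), ?_, ?_, ?_⟩
    · exact iSup₂_mono fun a _ => Submodule.map_mono (hS a)
    · simpa using finrank_iSup_le_mul (Finset.univ : Finset (Fin t))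
        (fun a => (S a).map ((inj a).restrictScalars K)) r
        (fun a => (Submodule.finrank_map_le _ (S a)).trans (hd a))
    · have hsum : v = ∑ a, inj a (fun j => v (e.symm (a, j))) := by
        ext x
        simp [Finset.sum_apply, hinj]
      rw [hsum]
      refine Submodule.sum_mem _ fun a _ => ?_
      have h4 := Submodule.mem_map_of_mem (f := inj a) (hv a)
      rw [Submodule.map_span] at h4
      refine Submodule.span_mono ?_ h4
      rintro _ ⟨x, hx, rfl⟩
      exact Submodule.mem_iSup_of_mem a (Submodule.mem_iSup_of_mem (Finset.mem_univ a)
        ⟨x, hx, rfl⟩)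

/-- For positive integers `t, s, h` with `ts ≤ min{tsh, m}`:
`s_{q^m/q}(tsh, ts) ≤ t · s_{q^m/q}(sh, s)`. -/
theorem sMin_repeated (K L : Type*) [Field K] [Field L] [Algebra K L]
    [Fintype K] [Fintype L] {t s h : ℕ}
    (ht : 0 < t) (hs : 0 < s) (hh : 0 < h)
    (hts : t * s ≤ min (t * s * h) (Module.finrank K L)) :
    sMin K L (t * s * h) (t * s) ≤ t * sMin K L (s * h) s := by
  have : FiniteDimensional K L := Module.Finite.of_finite
  obtain ⟨h1, h2⟩ := le_min_iff.1 hts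
  have hne : {n : ℕ | ∃ U : Submodule K (Fin (s * h) → L),
      Module.finrank K U = n ∧ Submodule.span L (U : Set (Fin (s * h) → L)) = ⊤ ∧
      IsRankSat K U s}.Nonempty := by
    obtain ⟨U', -, u2, u3⟩ := exists_exact (K := K) (L := L) (k := s * h) (ρ := s) ⊤
      (covers_top.mono hs) hs (Nat.le_mul_of_pos_right s hh)
      ((Nat.le_mul_of_pos_left s ht).trans h2)
    exact ⟨_, U', rfl, u2, u3⟩
  obtain ⟨U, u1, -, u3⟩ := Nat.sInf_mem hne
  have e : Fin (t * s * h) ≃ Fin t × Fin (s * h) :=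
    (finCongr (mul_assoc t s h)).trans finProdFinEquiv.symm
  obtain ⟨W, w1, w2⟩ := covers_repeat e U u3.1
  obtain ⟨W', x1, x2, x3⟩ := exists_exact W w2 (Nat.mul_pos ht hs) h1 h2
  have hle : sMin K L (t * s * h) (t * s) ≤ Module.finrank K W' :=
    Nat.sInf_le ⟨W', rfl, x2, x3⟩
  refine hle.trans (x1.trans (w1.trans ?_))
  rw [u1]
  rfl
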